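/- Let W ⊆ ℂ² be open, γ : [0,1] → W a piecewise continuously differentiable path, g : W → ℂ holomorphic, ω₁, …, ω_n holomorphic 1-forms on W, and let 1 ≤ i ≤ n−1. Then ∫_γ ω₁ ⋯ ω_i (dg) ω_{i+1} ⋯ ω_n = ∫_γ ω₁ ⋯ ω_{i−1} (g·ω_i) ω_{i+1} ⋯ ω_n − ∫_γ ω₁ ⋯ ω_i (g·ω_{i+1}) ω_{i+2} ⋯ ω_n. -/

import Mathlib

/-- A 1-form `P dx + Q dy` on `ℂ²` (with coordinates `(x, y)`),
given by its pair of coefficient functions `(P, Q)`. -/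
abbrev Form1 : Type := ((ℂ × ℂ) → ℂ) × ((ℂ × ℂ) → ℂ)

/-- `ω` is a holomorphic 1-form on `W`. -/
def HolFormOn (W : Set (ℂ × ℂ)) (ω : Form1) : Prop :=
  DifferentiableOn ℂ ω.1 W ∧ DifferentiableOn ℂ ω.2 W

/-- The pullback `γ*ω` of the 1-form `ω = P dx + Q dy` along a path `γ = (γ₁, γ₂)`:
`(γ*ω)(s) = P(γ(s))·γ₁′(s) + Q(γ(s))·γ₂′(s)`. -/
noncomputable def pull (γ : ℝ → ℂ × ℂ) (ω : Form1) (s : ℝ) : ℂ :=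
  ω.1 (γ s) * deriv (fun u => (γ u).1) s + ω.2 (γ s) * deriv (fun u => (γ u).2) s

/-- The iterated integral `I(γ; ω₁,…,ω_k; s)`, defined recursively:
`I(γ; ; s) = 1` and `I(γ; ω₁,…,ω_k; s) = ∫₀^s (γ*ω₁)(u) · I(γ; ω₂,…,ω_k; u) du`.
The iterated integral `∫_γ ω₁⋯ω_k` is `iterInt γ [ω₁,…,ω_k] 1`. -/
noncomputable def iterInt (γ : ℝ → ℂ × ℂ) : List Form1 → ℝ → ℂ
  | [], _ => 1
  | ω :: ωs, s => ∫ u in (0:ℝ)..s, pull γ ω u * iterInt γ ωs u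

/-- `γ : [0,1] → ℂ²` is a piecewise continuously differentiable path. -/
def PiecewiseC1 (γ : ℝ → ℂ × ℂ) : Prop :=
  ContinuousOn γ (Set.Icc 0 1) ∧
  ∃ (n : ℕ) (t : Fin (n + 1) → ℝ), StrictMono t ∧ t 0 = 0 ∧ t (Fin.last n) = 1 ∧
    ∀ i : Fin n, ContDiffOn ℝ 1 γ (Set.Icc (t i.castSucc) (t i.succ))

/-- The differential `dg = (∂g/∂x) dx + (∂g/∂y) dy` of a function `g`. -/
noncomputable def dform (g : ℂ × ℂ → ℂ) : Form1 :=
  (fun p => fderiv ℂ g p (1, 0), fun p => fderiv ℂ g p (0, 1))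

/-- The 1-form `g·ω`. -/
def smulForm (g : ℂ × ℂ → ℂ) (ω : Form1) : Form1 :=
  (fun p => g p * ω.1 p, fun p => g p * ω.2 p)

open Set Filter Topology MeasureTheory intervalIntegral

/-- The directional derivatives of a holomorphic function of several variables are continuous. -/
lemma continuousOn_fderiv_apply_of_differentiableOn
    {E F : Type*} [NormedAddCommGroup E] [NormedSpace ℂ E] [NormedAddCommGroup F] [NormedSpace ℂ F]
    {W : Set E} (hW : IsOpen W) {g : E → F} (hg : DifferentiableOn ℂ g W) (v : E) :
    ContinuousOn (fun p => fderiv ℂ g p v) W := by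
  intro p₀ hp₀
  apply ContinuousAt.continuousWithinAt
  have hline : ∀ p : E, Continuous fun z : ℂ => p + z • v := fun p => by fun_prop
  obtain ⟨r, hr, hball⟩ : ∃ r > 0, Metric.closedBall (0 : ℂ) r ⊆ {z | p₀ + z • v ∈ W} := by
    refine Metric.nhds_basis_closedBall.mem_iff.1 ((hW.preimage (hline p₀)).mem_nhds ?_)
    simpa using hp₀
  have hmem : ∀ᶠ p in 𝓝 p₀, ∀ z ∈ Metric.closedBall (0 : ℂ) r, p + z • v ∈ W := by
    refine (isCompact_closedBall (0 : ℂ) r).eventually_forall_of_forall_eventually fun z hz => ?_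
    have hc : Continuous fun q : E × ℂ => q.1 + q.2 • v := by fun_prop
    exact (hW.preimage hc).mem_nhds (hball hz)
  have hderiv : ∀ p, (∀ z ∈ Metric.closedBall (0 : ℂ) r, p + z • v ∈ W) →
      ∀ z ∈ Metric.closedBall (0 : ℂ) r,
        HasDerivAt (fun z : ℂ => g (p + z • v)) (fderiv ℂ g (p + z • v) v) z := by
    intro p hp z hz
    have h1 := (hg.differentiableAt (hW.mem_nhds (hp z hz))).hasFDerivAt
    have h2 : HasDerivAt (fun z : ℂ => p + z • v) v z := by
      simpa using ((hasDerivAt_id z).smul_const v).const_add p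
    exact h1.comp_hasDerivAt z h2
  rw [ContinuousAt, Metric.tendsto_nhds]
  intro ε hε
  have hclose : ∀ᶠ p in 𝓝 p₀, ∀ z ∈ Metric.closedBall (0 : ℂ) r,
      ‖g (p + z • v) - g (p₀ + z • v)‖ < ε / 2 * r := by
    refine (isCompact_closedBall (0 : ℂ) r).eventually_forall_of_forall_eventually fun z hz => ?_
    have hgc : ContinuousAt g (p₀ + z • v) :=
      (hg.differentiableAt (hW.mem_nhds (hball hz))).continuousAt
    have h1 : ContinuousAt (fun q : E × ℂ => g (q.1 + q.2 • v)) (p₀, z) :=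
      ContinuousAt.comp (f := fun q : E × ℂ => q.1 + q.2 • v) hgc
        (Continuous.continuousAt (by fun_prop))
    have h2 : ContinuousAt (fun q : E × ℂ => g (p₀ + q.2 • v)) (p₀, z) :=
      ContinuousAt.comp (f := fun q : E × ℂ => p₀ + q.2 • v) hgc
        (Continuous.continuousAt (by fun_prop))
    exact (h1.sub h2).norm.eventually_lt_const (by simpa using by positivity)
  filter_upwards [hmem, hclose] with p hp hcl
  have hdiff : ∀ z ∈ Metric.closedBall (0 : ℂ) r,
      HasDerivAt (fun z : ℂ => g (p + z • v) - g (p₀ + z • v))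
        (fderiv ℂ g (p + z • v) v - fderiv ℂ g (p₀ + z • v) v) z := fun z hz =>
    (hderiv p hp z hz).sub (hderiv p₀ (fun z hz => hball hz) z hz)
  have hcauchy := Complex.norm_deriv_le_of_forall_mem_sphere_norm_le hr
    (f := fun z : ℂ => g (p + z • v) - g (p₀ + z • v)) (C := ε / 2 * r)
    (DifferentiableOn.diffContOnCl_ball (U := Metric.closedBall 0 r)
      (fun z hz => (hdiff z hz).differentiableAt.differentiableWithinAt) subset_rfl)
    fun z hz => (hcl z (Metric.sphere_subset_closedBall hz)).le
  rw [(hdiff 0 (Metric.mem_closedBall_self hr.le)).deriv, mul_div_cancel_right₀ _ hr.ne'] at hcauchy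
  rw [dist_eq_norm]
  simp only [zero_smul, add_zero] at hcauchy
  linarith

lemma continuousOn_dform {W : Set (ℂ × ℂ)} (hW : IsOpen W) {g : ℂ × ℂ → ℂ}
    (hg : DifferentiableOn ℂ g W) :
    ContinuousOn (dform g).1 W ∧ ContinuousOn (dform g).2 W :=
  ⟨continuousOn_fderiv_apply_of_differentiableOn hW hg _,
    continuousOn_fderiv_apply_of_differentiableOn hW hg _⟩

lemma HolFormOn.smulForm {W : Set (ℂ × ℂ)} {g : ℂ × ℂ → ℂ} {ω : Form1}
    (hg : DifferentiableOn ℂ g W) (hω : HolFormOn W ω) : HolFormOn W (smulForm g ω) :=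
  ⟨hg.mul hω.1, hg.mul hω.2⟩

lemma pull_smulForm (γ : ℝ → ℂ × ℂ) (g : ℂ × ℂ → ℂ) (ω : Form1) (s : ℝ) :
    pull γ (smulForm g ω) s = g (γ s) * pull γ ω s := by
  simp only [pull, smulForm]
  ring

lemma ContDiffOn.intervalIntegrable_deriv {E : Type*} [NormedAddCommGroup E] [NormedSpace ℝ E]
    {f : ℝ → E} {a b : ℝ} (hab : a < b) (hf : ContDiffOn ℝ 1 f (Icc a b)) :
    IntervalIntegrable (deriv f) volume a b := by
  have h : ContinuousOn (derivWithin f (Icc a b)) (uIcc a b) := by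
    rw [uIcc_of_le hab.le]
    exact hf.continuousOn_derivWithin (uniqueDiffOn_Icc hab) le_rfl
  refine h.intervalIntegrable.congr_uIoo fun x hx => ?_
  rw [uIoo_of_le hab.le] at hx
  exact derivWithin_of_mem_nhds (Icc_mem_nhds hx.1 hx.2)

lemma PiecewiseC1.intervalIntegrable_deriv {γ : ℝ → ℂ × ℂ} (hγ : PiecewiseC1 γ) :
    IntervalIntegrable (deriv fun u => (γ u).1) volume 0 1 ∧
      IntervalIntegrable (deriv fun u => (γ u).2) volume 0 1 := by
  obtain ⟨-, n, t, ht, h0, h1, hC⟩ := hγ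
  have key : ∀ i, IntervalIntegrable (deriv fun u => (γ u).1) volume 0 (t i) ∧
      IntervalIntegrable (deriv fun u => (γ u).2) volume 0 (t i) := by
    intro i
    induction i using Fin.induction with
    | zero => simp [h0]
    | succ i ih =>
      have hlt : t i.castSucc < t i.succ := ht i.castSucc_lt_succ
      exact ⟨ih.1.trans (ContDiffOn.intervalIntegrable_deriv hlt (hC i).fst),
        ih.2.trans (ContDiffOn.intervalIntegrable_deriv hlt (hC i).snd)⟩
  simpa [h1] using key (Fin.last n)

lemma PiecewiseC1.exists_finite_contDiffAt {γ : ℝ → ℂ × ℂ} (hγ : PiecewiseC1 γ) :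
    ∃ S : Set ℝ, S.Finite ∧ ∀ s ∈ Ioo (0 : ℝ) 1 \ S, ContDiffAt ℝ 1 γ s := by
  obtain ⟨-, n, t, ht, h0, h1, hC⟩ := hγ
  refine ⟨range t, finite_range t, ?_⟩
  have key : ∀ i, ∀ s ∈ Ioo 0 (t i) \ range t, ContDiffAt ℝ 1 γ s := by
    intro i
    induction i using Fin.induction with
    | zero => simp [h0]
    | succ i ih =>
      rintro s ⟨⟨hs0, hs1⟩, hsS⟩
      rcases lt_trichotomy s (t i.castSucc) with h | h | h
      · exact ih s ⟨⟨hs0, h⟩, hsS⟩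
      · exact absurd ⟨_, h.symm⟩ hsS
      · exact (hC i).contDiffAt (Icc_mem_nhds h hs1)
  simpa [h1] using key (Fin.last n)

lemma intervalIntegrable_pull {γ : ℝ → ℂ × ℂ} (hγ : PiecewiseC1 γ) {W : Set (ℂ × ℂ)}
    (hγW : MapsTo γ (Icc 0 1) W) {ω : Form1} (h1 : ContinuousOn ω.1 W) (h2 : ContinuousOn ω.2 W) :
    IntervalIntegrable (pull γ ω) volume 0 1 := by
  have hu : uIcc (0 : ℝ) 1 = Icc 0 1 := uIcc_of_le zero_le_one
  have hd := hγ.intervalIntegrable_deriv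
  exact (hd.1.continuousOn_mul (hu ▸ h1.comp hγ.1 hγW)).add
    (hd.2.continuousOn_mul (hu ▸ h2.comp hγ.1 hγW))

lemma continuousAt_pull {γ : ℝ → ℂ × ℂ} {s : ℝ} (hγ : ContDiffAt ℝ 1 γ s) {ω : Form1}
    (h1 : ContinuousAt ω.1 (γ s)) (h2 : ContinuousAt ω.2 (γ s)) :
    ContinuousAt (pull γ ω) s := by
  have hd : ∀ {f : ℝ → ℂ}, ContDiffAt ℝ 1 f s → ContinuousAt (deriv f) s := fun hf =>
    (hf.continuousAt_fderiv one_ne_zero).clm_apply continuousAt_const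
  exact ((h1.comp hγ.continuousAt).mul (hd hγ.fst)).add
    ((h2.comp hγ.continuousAt).mul (hd hγ.snd))

lemma hasDerivAt_comp_pull_dform {γ : ℝ → ℂ × ℂ} {s : ℝ} (hγ : DifferentiableAt ℝ γ s)
    {g : ℂ × ℂ → ℂ} (hg : DifferentiableAt ℂ g (γ s)) :
    HasDerivAt (fun u => g (γ u)) (pull γ (dform g) s) s := by
  have h := (hg.hasFDerivAt.restrictScalars ℝ).comp_hasDerivAt s
    (hγ.fst.hasDerivAt.prodMk hγ.snd.hasDerivAt)
  refine h.congr_deriv ?_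
  have hsplit : ∀ a b : ℂ, fderiv ℂ g (γ s) (a, b)
      = fderiv ℂ g (γ s) (1, 0) * a + fderiv ℂ g (γ s) (0, 1) * b := by
    intro a b
    have : ((a, b) : ℂ × ℂ) = a • (1, 0) + b • (0, 1) := by simp
    rw [this, map_add, map_smul, map_smul, smul_eq_mul, smul_eq_mul, mul_comm a, mul_comm b]
  exact hsplit _ _

/-- Integration by parts of a function, differentiable off a finite set, against a primitive. -/
lemma integral_deriv_mul_primitive {G G' h : ℝ → ℂ} {S : Set ℝ} (hS : S.Finite)
    (hG : ContinuousOn G (Icc 0 1)) (hG' : ∀ s ∈ Ioo (0 : ℝ) 1 \ S, HasDerivAt G (G' s) s)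
    (hG'i : IntervalIntegrable G' volume 0 1) (hi : IntervalIntegrable h volume 0 1)
    (hc : ∀ s ∈ Ioo (0 : ℝ) 1 \ S, ContinuousAt h s) {s : ℝ} (hs : s ∈ Icc (0 : ℝ) 1) :
    ∫ u in (0 : ℝ)..s, G' u * ∫ v in (0 : ℝ)..u, h v
      = G s * (∫ v in (0 : ℝ)..s, h v) - ∫ u in (0 : ℝ)..s, G u * h u := by
  have hu : uIcc (0 : ℝ) 1 = Icc 0 1 := uIcc_of_le zero_le_one
  have hF : ContinuousOn (fun u => ∫ v in (0 : ℝ)..u, h v) (Icc 0 1) :=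
    hu ▸ continuousOn_primitive_interval' hi left_mem_uIcc
  have hsub : ∀ x ∈ Icc (0 : ℝ) 1, uIcc 0 x ⊆ uIcc (0 : ℝ) 1 := fun x hx =>
    uIcc_subset_uIcc_left (hu ▸ hx)
  have i1 := (hG'i.mul_continuousOn (hu ▸ hF)).mono_set (hsub s hs)
  have i2 := (hi.continuousOn_mul (hu ▸ hG)).mono_set (hsub s hs)
  have hftc := integral_eq_of_hasDerivAt_off_countable_of_le
    (fun u => G u * ∫ v in (0 : ℝ)..u, h v) (fun u => G' u * (∫ v in (0 : ℝ)..u, h v) + G u * h u)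
    hs.1 hS.countable ((hG.mul hF).mono (Icc_subset_Icc_right hs.2)) (fun x hx => by
      have hx1 : x ∈ Ioo (0 : ℝ) 1 \ S := ⟨⟨hx.1.1, hx.1.2.trans_le hs.2⟩, hx.2⟩
      refine (hG' x hx1).mul (integral_hasDerivAt_right
        (hi.mono_set (hsub x (Ioo_subset_Icc_self hx1.1))) ?_ (hc x hx1))
      exact ⟨Ioc 0 1, Ioc_mem_nhds hx1.1.1 hx1.1.2, hi.1.aestronglyMeasurable⟩) (i1.add i2)
  rw [intervalIntegral.integral_add i1 i2] at hftc
  simp only [integral_same, mul_zero, sub_zero] at hftc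
  exact eq_sub_of_add_eq hftc

lemma continuousOn_iterInt {γ : ℝ → ℂ × ℂ} (l : List Form1)
    (hl : ∀ ω ∈ l, IntervalIntegrable (pull γ ω) volume 0 1) :
    ContinuousOn (iterInt γ l) (Icc 0 1) := by
  have hu : uIcc (0 : ℝ) 1 = Icc 0 1 := uIcc_of_le zero_le_one
  induction l with
  | nil => exact continuousOn_const
  | cons ω l ih =>
    rw [List.forall_mem_cons] at hl
    exact hu ▸ continuousOn_primitive_interval' (hl.1.mul_continuousOn (hu ▸ ih hl.2)) left_mem_uIcc

lemma intervalIntegrable_pull_mul_iterInt {γ : ℝ → ℂ × ℂ} {ω : Form1} {l : List Form1}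
    (hω : IntervalIntegrable (pull γ ω) volume 0 1)
    (hl : ∀ η ∈ l, IntervalIntegrable (pull γ η) volume 0 1) {s : ℝ} (hs : s ∈ Icc (0 : ℝ) 1) :
    IntervalIntegrable (fun u => pull γ ω u * iterInt γ l u) volume 0 s := by
  have hu : uIcc (0 : ℝ) 1 = Icc 0 1 := uIcc_of_le zero_le_one
  exact (hω.mul_continuousOn (hu ▸ continuousOn_iterInt l hl)).mono_set
    (uIcc_subset_uIcc_left (hu ▸ hs))

/-- A linear relation between iterated integrals persists after prepending a form. -/
lemma iterInt_cons_eq_sub {γ : ℝ → ℂ × ℂ} {ω : Form1} {l l₁ l₂ : List Form1}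
    (hω : IntervalIntegrable (pull γ ω) volume 0 1)
    (h₁ : ∀ η ∈ l₁, IntervalIntegrable (pull γ η) volume 0 1)
    (h₂ : ∀ η ∈ l₂, IntervalIntegrable (pull γ η) volume 0 1)
    (h : ∀ s ∈ Icc (0 : ℝ) 1, iterInt γ l s = iterInt γ l₁ s - iterInt γ l₂ s)
    {s : ℝ} (hs : s ∈ Icc (0 : ℝ) 1) :
    iterInt γ (ω :: l) s = iterInt γ (ω :: l₁) s - iterInt γ (ω :: l₂) s := by
  simp only [iterInt]
  rw [← intervalIntegral.integral_sub (intervalIntegrable_pull_mul_iterInt hω h₁ hs)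
    (intervalIntegrable_pull_mul_iterInt hω h₂ hs)]
  refine integral_congr fun u hu => ?_
  rw [uIcc_of_le hs.1] at hu
  simp only [h u ⟨hu.1, hu.2.trans hs.2⟩, mul_sub]

/-- Integrating an exact form in the first slot. -/
lemma iterInt_dform_cons {W : Set (ℂ × ℂ)} (hW : IsOpen W) {γ : ℝ → ℂ × ℂ} (hγ : PiecewiseC1 γ)
    (hγW : MapsTo γ (Icc 0 1) W) {g : ℂ × ℂ → ℂ} (hg : DifferentiableOn ℂ g W)
    {ω : Form1} {l : List Form1} (hω : HolFormOn W ω) (hl : ∀ η ∈ l, HolFormOn W η)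
    {s : ℝ} (hs : s ∈ Icc (0 : ℝ) 1) :
    iterInt γ (dform g :: ω :: l) s
      = g (γ s) * iterInt γ (ω :: l) s - iterInt γ (smulForm g ω :: l) s := by
  obtain ⟨S, hS, hSγ⟩ := hγ.exists_finite_contDiffAt
  have hli : ∀ η ∈ l, IntervalIntegrable (pull γ η) volume 0 1 := fun η hη =>
    intervalIntegrable_pull hγ hγW (hl η hη).1.continuousOn (hl η hη).2.continuousOn
  have hωi := intervalIntegrable_pull hγ hγW hω.1.continuousOn hω.2.continuousOn
  have hdi := intervalIntegrable_pull hγ hγW (continuousOn_dform hW hg).1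
    (continuousOn_dform hW hg).2
  have hmem : ∀ x ∈ Ioo (0 : ℝ) 1 \ S, W ∈ 𝓝 (γ x) := fun x hx =>
    hW.mem_nhds (hγW (Ioo_subset_Icc_self hx.1))
  have key := integral_deriv_mul_primitive hS (hg.continuousOn.comp hγ.1 hγW)
    (fun x hx => hasDerivAt_comp_pull_dform ((hSγ x hx).differentiableAt one_ne_zero)
      (hg.differentiableAt (hmem x hx)))
    hdi (intervalIntegrable_pull_mul_iterInt hωi hli (right_mem_Icc.2 zero_le_one))
    (fun x hx => (continuousAt_pull (hSγ x hx) (hω.1.continuousOn.continuousAt (hmem x hx))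
      (hω.2.continuousOn.continuousAt (hmem x hx))).mul
      ((continuousOn_iterInt l hli).continuousAt (Icc_mem_nhds hx.1.1 hx.1.2))) hs
  simpa only [iterInt, pull_smulForm, mul_assoc, Function.comp_apply] using key

/-- Integrating an exact form `dg` in a middle slot of an iterated integral: for
`1 ≤ i ≤ n−1` (here `A = ω₁⋯ω_{i−1}` and `B = ω_{i+2}⋯ω_n`),
`∫_γ ω₁ ⋯ ω_i (dg) ω_{i+1} ⋯ ω_n = ∫_γ ω₁ ⋯ ω_{i−1} (g·ω_i) ω_{i+1} ⋯ ω_n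
  − ∫_γ ω₁ ⋯ ω_i (g·ω_{i+1}) ω_{i+2} ⋯ ω_n`. -/
theorem iterated_integral_exact_middle
    (W : Set (ℂ × ℂ)) (hW : IsOpen W)
    (γ : ℝ → ℂ × ℂ) (hγ : PiecewiseC1 γ) (hγW : ∀ s ∈ Set.Icc (0:ℝ) 1, γ s ∈ W)
    (g : ℂ × ℂ → ℂ) (hg : DifferentiableOn ℂ g W)
    (A B : List Form1) (ωi ωj : Form1)
    (hA : ∀ ω ∈ A, HolFormOn W ω) (hB : ∀ ω ∈ B, HolFormOn W ω)
    (hωi : HolFormOn W ωi) (hωj : HolFormOn W ωj) :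
    iterInt γ (A ++ ωi :: dform g :: ωj :: B) 1
      = iterInt γ (A ++ smulForm g ωi :: ωj :: B) 1
        - iterInt γ (A ++ ωi :: smulForm g ωj :: B) 1 := by
  have hint : ∀ {ω : Form1}, HolFormOn W ω → IntervalIntegrable (pull γ ω) volume 0 1 := fun hω =>
    intervalIntegrable_pull hγ hγW hω.1.continuousOn hω.2.continuousOn
  have hgi := hint (hωi.smulForm hg)
  have hgj := hint (hωj.smulForm hg)
  have hBi : ∀ ω ∈ B, IntervalIntegrable (pull γ ω) volume 0 1 := fun ω hω => hint (hB ω hω)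
  have hjB : ∀ ω ∈ ωj :: B, IntervalIntegrable (pull γ ω) volume 0 1 :=
    List.forall_mem_cons.2 ⟨hint hωj, hBi⟩
  have hgjB : ∀ ω ∈ smulForm g ωj :: B, IntervalIntegrable (pull γ ω) volume 0 1 :=
    List.forall_mem_cons.2 ⟨hgj, hBi⟩
  suffices H : ∀ s ∈ Icc (0 : ℝ) 1, iterInt γ (A ++ ωi :: dform g :: ωj :: B) s
      = iterInt γ (A ++ smulForm g ωi :: ωj :: B) s
        - iterInt γ (A ++ ωi :: smulForm g ωj :: B) s from H 1 (right_mem_Icc.2 zero_le_one)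
  induction A with
  | nil =>
    intro s hs
    rw [List.nil_append, List.nil_append, List.nil_append, iterInt, iterInt, iterInt,
      ← intervalIntegral.integral_sub (intervalIntegrable_pull_mul_iterInt hgi hjB hs)
        (intervalIntegrable_pull_mul_iterInt (hint hωi) hgjB hs)]
    refine integral_congr fun u hu => ?_
    rw [uIcc_of_le hs.1] at hu
    simp only [iterInt_dform_cons hW hγ hγW hg hωj hB ⟨hu.1, hu.2.trans hs.2⟩, pull_smulForm]
    ring
  | cons ω A ih =>
    rw [List.forall_mem_cons] at hA
    have hAi : ∀ ω ∈ A, IntervalIntegrable (pull γ ω) volume 0 1 := fun ω hω => hint (hA.2 ω hω)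
    intro s hs
    exact iterInt_cons_eq_sub (hint hA.1)
      (List.forall_mem_append.2 ⟨hAi, List.forall_mem_cons.2 ⟨hgi, hjB⟩⟩)
      (List.forall_mem_append.2 ⟨hAi, List.forall_mem_cons.2 ⟨hint hωi, hgjB⟩⟩) (ih hA.2) hs
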